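/- arXiv:1412.0815 — 2 statements merged into one kernel-verified Lean document; each statement's English description precedes it below -/
import Mathlib

section
/- Let (b,c) be a connected graph over a countably infinite set X. Then the following are equivalent: (i) (b,c) is uniformly transient, i.e. D₀ ⊆ C₀(X); (ii) the metric space (X, γ_o) has finite diameter for one (equivalently, for all) o ∈ X; (iii) the metric space (X, γ) has finite diameter. -/
open ENNReal Filter Topology

namespace UTGraph

variable {X : Type*}

/-- A graph over `X`: symmetric nonnegative edge weight `b` with zero diagonal and
summable rows, together with a nonnegative potential (killing term) `c`. -/
structure IsGraph (b : X → X → ℝ) (c : X → ℝ) : Prop where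
  symm : ∀ x y, b x y = b y x
  nonneg : ∀ x y, 0 ≤ b x y
  loopless : ∀ x, b x x = 0
  row_summable : ∀ x, Summable fun y => b x y
  c_nonneg : ∀ x, 0 ≤ c x

/-- Connectedness: any two vertices are joined by a path of positive edge weights. -/
def Connected (b : X → X → ℝ) : Prop :=
  ∀ x y : X, Relation.ReflTransGen (fun u v => 0 < b u v) x y

/-- The energy form `Q(f)`, with values in `[0,∞]`. -/
noncomputable def energy (b : X → X → ℝ) (c : X → ℝ) (f : X → ℝ) : ℝ≥0∞ :=
  (1 / 2) * ∑' p : X × X, ENNReal.ofReal (b p.1 p.2 * (f p.1 - f p.2) ^ 2)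
    + ∑' x, ENNReal.ofReal (c x * f x ^ 2)

/-- `f` has finite energy, i.e. `f ∈ D`. -/
def FiniteEnergy (b : X → X → ℝ) (c : X → ℝ) (f : X → ℝ) : Prop :=
  energy b c f < ⊤

/-- The bilinear energy form `Q(f,g)` (for finite-energy functions). -/
noncomputable def energyBilin (b : X → X → ℝ) (c : X → ℝ) (f g : X → ℝ) : ℝ :=
  (1 / 2) * ∑' p : X × X, b p.1 p.2 * (f p.1 - f p.2) * (g p.1 - g p.2)
    + ∑' x, c x * f x * g x

/-- `f ∈ C_c(X)`: finitely supported function. -/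
def FinSupp (f : X → ℝ) : Prop := (Function.support f).Finite

/-- The norm `‖f‖_o = (Q(f) + f(o)²)^{1/2}`. -/
noncomputable def normO (b : X → X → ℝ) (c : X → ℝ) (o : X) (f : X → ℝ) : ℝ :=
  Real.sqrt ((energy b c f).toReal + f o ^ 2)

/-- `f ∈ D₀`: there is a sequence of finitely supported functions converging to `f`
pointwise whose energy difference to `f` tends to `0`. -/
def MemD0 (b : X → X → ℝ) (c : X → ℝ) (f : X → ℝ) : Prop :=
  ∃ φ : ℕ → X → ℝ, (∀ n, FinSupp (φ n)) ∧
    (∀ x, Tendsto (fun n => φ n x) atTop (𝓝 (f x))) ∧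
    Tendsto (fun n => energy b c (φ n - f)) atTop (𝓝 0)

/-- `f ∈ C₀(X)`: `f` belongs to the uniform closure of the finitely supported functions,
i.e. for every `ε > 0` the set where `|f| ≥ ε` is finite. -/
def MemC0 (f : X → ℝ) : Prop := ∀ ε : ℝ, 0 < ε → {x | ε ≤ |f x|}.Finite

/-- The graph is uniformly transient: `D₀ ⊆ C₀(X)`. -/
def UniformlyTransient (b : X → X → ℝ) (c : X → ℝ) : Prop :=
  ∀ f : X → ℝ, MemD0 b c f → MemC0 f

/-- The capacity of a point: `cap(x) = inf {Q(φ) : φ ∈ C_c(X), φ(x) = 1}`. -/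
noncomputable def cap (b : X → X → ℝ) (c : X → ℝ) (x : X) : ℝ≥0∞ :=
  ⨅ (φ : X → ℝ) (_ : FinSupp φ) (_ : φ x = 1), energy b c φ

/-- `f ∈ F`: the domain of the formal Laplacian. -/
def MemF (b : X → X → ℝ) (f : X → ℝ) : Prop :=
  ∀ x, Summable fun y => b x y * |f y|

/-- The formal Laplacian `𝓛 f (x) = Σ_y b(x,y)(f(x) - f(y)) + c(x) f(x)`. -/
noncomputable def formalLaplacian (b : X → X → ℝ) (c : X → ℝ) (f : X → ℝ) (x : X) : ℝ :=
  (∑' y, b x y * (f x - f y)) + c x * f x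

/-- `f` is harmonic: `f ∈ F` and `𝓛 f = 0`. -/
def Harmonic (b : X → X → ℝ) (c : X → ℝ) (f : X → ℝ) : Prop :=
  MemF b f ∧ ∀ x, formalLaplacian b c f x = 0

/-- The graph is recurrent: the constant function `1` lies in `D₀` and `Q(1) = 0`. -/
def Recurrent (b : X → X → ℝ) (c : X → ℝ) : Prop :=
  MemD0 b c 1 ∧ energy b c 1 = 0

/-- The graph is transient: not recurrent. -/
def Transient (b : X → X → ℝ) (c : X → ℝ) : Prop := ¬ Recurrent b c

/-- The metric `γ_o`. -/
noncomputable def gammaO (b : X → X → ℝ) (c : X → ℝ) (o x y : X) : ℝ :=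
  sSup {d : ℝ | ∃ φ : X → ℝ, FinSupp φ ∧
    energy b c φ + ENNReal.ofReal (φ o ^ 2) ≤ 1 ∧ d = |φ x - φ y|}

/-- The metric `γ`. -/
noncomputable def gamma (b : X → X → ℝ) (c : X → ℝ) (x y : X) : ℝ :=
  sSup {d : ℝ | ∃ φ : X → ℝ, FinSupp φ ∧ energy b c φ ≤ 1 ∧ d = |φ x - φ y|}

/-- `d` is a metric on `X`. -/
def IsMetric (d : X → X → ℝ) : Prop :=
  (∀ x y, 0 ≤ d x y) ∧ (∀ x y, d x y = d y x) ∧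
  (∀ x y, d x y = 0 ↔ x = y) ∧ (∀ x y z, d x z ≤ d x y + d y z)

/-- `f` belongs to the closure of `C_c(X)` with respect to the norm
`‖·‖_Q = (Q(·) + ‖·‖_m²)^{1/2}` inside `D ∩ ℓ²(X,m)`. -/
def MemFormDomain (b : X → X → ℝ) (c : X → ℝ) (m : X → ℝ) (f : X → ℝ) : Prop :=
  FiniteEnergy b c f ∧ Summable (fun x => m x * f x ^ 2) ∧
  ∃ φ : ℕ → X → ℝ, (∀ n, FinSupp (φ n)) ∧
    Tendsto (fun n => energy b c (f - φ n)
      + ∑' x, ENNReal.ofReal (m x * (f x - φ n x) ^ 2)) atTop (𝓝 0)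

end UTGraph

open scoped NNReal

namespace UTGraph

variable {X : Type*} {b : X → X → ℝ} {c : X → ℝ}

lemma energy_le_energy (h : IsGraph b c) {f g : X → ℝ}
    (hd : ∀ x y, (f x - f y) ^ 2 ≤ (g x - g y) ^ 2) (hp : ∀ x, f x ^ 2 ≤ g x ^ 2) :
    energy b c f ≤ energy b c g := by
  unfold energy
  gcongr 1 / 2 * (∑' p, ENNReal.ofReal ?_) + ∑' x, ENNReal.ofReal ?_ with p x
  · exact mul_le_mul_of_nonneg_left (hd _ _) (h.nonneg _ _)
  · exact mul_le_mul_of_nonneg_left (hp _) (h.c_nonneg _)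

lemma energy_abs_le (h : IsGraph b c) (f : X → ℝ) :
    energy b c (fun x => |f x|) ≤ energy b c f :=
  energy_le_energy h (fun _ _ => sq_le_sq.2 (abs_abs_sub_abs_le_abs_sub _ _))
    fun _ => (sq_abs _).le

lemma energy_const_mul (a : ℝ) (f : X → ℝ) :
    energy b c (fun x => a * f x) = ENNReal.ofReal (a ^ 2) * energy b c f := by
  have h1 (p : X × X) : ENNReal.ofReal (b p.1 p.2 * (a * f p.1 - a * f p.2) ^ 2) =
      ENNReal.ofReal (a ^ 2) * ENNReal.ofReal (b p.1 p.2 * (f p.1 - f p.2) ^ 2) := by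
    rw [← ENNReal.ofReal_mul (sq_nonneg a)]
    congr 1
    ring
  have h2 (x : X) : ENNReal.ofReal (c x * (a * f x) ^ 2) =
      ENNReal.ofReal (a ^ 2) * ENNReal.ofReal (c x * f x ^ 2) := by
    rw [← ENNReal.ofReal_mul (sq_nonneg a)]
    congr 1
    ring
  simp only [energy, h1, h2, ENNReal.tsum_mul_left]
  ring

lemma energy_sub_comm (f g : X → ℝ) : energy b c (f - g) = energy b c (g - f) := by
  have hneg : f - g = fun x => -1 * (g - f) x := by
    ext x
    simp
  rw [hneg, energy_const_mul]
  simp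

lemma ofReal_mul_add_sq_le {w : ℝ} (hw : 0 ≤ w) (s t : ℝ) :
    ENNReal.ofReal (w * (s + t) ^ 2) ≤
      2 * ENNReal.ofReal (w * s ^ 2) + 2 * ENNReal.ofReal (w * t ^ 2) := by
  rw [← ENNReal.ofReal_ofNat 2, ← ENNReal.ofReal_mul (by norm_num),
    ← ENNReal.ofReal_mul (by norm_num), ← ENNReal.ofReal_add (by positivity) (by positivity)]
  apply ENNReal.ofReal_le_ofReal
  nlinarith [mul_nonneg hw (sq_nonneg (s - t))]

lemma energy_add_le (h : IsGraph b c) (f g : X → ℝ) :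
    energy b c (f + g) ≤ 2 * energy b c f + 2 * energy b c g := by
  have h1 : ∑' p : X × X, ENNReal.ofReal (b p.1 p.2 * ((f + g) p.1 - (f + g) p.2) ^ 2) ≤
      2 * ∑' p : X × X, ENNReal.ofReal (b p.1 p.2 * (f p.1 - f p.2) ^ 2) +
      2 * ∑' p : X × X, ENNReal.ofReal (b p.1 p.2 * (g p.1 - g p.2) ^ 2) := by
    rw [← ENNReal.tsum_mul_left, ← ENNReal.tsum_mul_left, ← ENNReal.tsum_add]
    refine ENNReal.tsum_le_tsum fun p => ?_
    convert ofReal_mul_add_sq_le (h.nonneg p.1 p.2) (f p.1 - f p.2) (g p.1 - g p.2) using 3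
    simp only [Pi.add_apply]
    ring
  have h2 : ∑' x, ENNReal.ofReal (c x * (f + g) x ^ 2) ≤
      2 * ∑' x, ENNReal.ofReal (c x * f x ^ 2) + 2 * ∑' x, ENNReal.ofReal (c x * g x ^ 2) := by
    rw [← ENNReal.tsum_mul_left, ← ENNReal.tsum_mul_left, ← ENNReal.tsum_add]
    exact ENNReal.tsum_le_tsum fun x => ofReal_mul_add_sq_le (h.c_nonneg x) (f x) (g x)
  unfold energy
  calc _ ≤ _ := add_le_add (mul_le_mul_right h1 _) h2
    _ = _ := by ring

lemma energy_sub_le (h : IsGraph b c) (f g : X → ℝ) :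
    energy b c (f - g) ≤ 2 * energy b c f + 2 * energy b c g := by
  have hg : energy b c (-g) = energy b c g := by simpa using energy_sub_comm (b := b) (c := c) 0 g
  simpa only [sub_eq_add_neg, hg] using energy_add_le h f (-g)

lemma lowerSemicontinuous_energy (b : X → X → ℝ) (c : X → ℝ) :
    LowerSemicontinuous (energy b c) := by
  unfold energy
  simp only [← ENNReal.tsum_mul_left]
  refine (lowerSemicontinuous_tsum fun p => ?_).add (lowerSemicontinuous_tsum fun x => ?_)
  · refine Continuous.lowerSemicontinuous ?_
    exact (ENNReal.continuous_const_mul (by simp)).comp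
      (ENNReal.continuous_ofReal.comp (by fun_prop))
  · exact (ENNReal.continuous_ofReal.comp (by fun_prop)).lowerSemicontinuous

/-- Fatou's lemma for the energy. -/
lemma energy_le_of_tendsto {u : ℕ → X → ℝ} {f : X → ℝ} {C : ℝ≥0∞}
    (hu : ∀ x, Tendsto (fun n => u n x) atTop (𝓝 (f x)))
    (hC : ∀ᶠ n in atTop, energy b c (u n) ≤ C) : energy b c f ≤ C := by
  by_contra! hlt
  have := (tendsto_pi_nhds.2 hu).eventually (lowerSemicontinuous_energy b c f C hlt)
  obtain ⟨n, h1, h2⟩ := (this.and hC).exists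
  exact absurd h1 h2.not_gt

lemma ofReal_sub_sq_le (x y z : ℝ) : ENNReal.ofReal ((x - z) ^ 2) ≤
    2 * ENNReal.ofReal ((x - y) ^ 2) + 2 * ENNReal.ofReal ((y - z) ^ 2) := by
  simpa using ofReal_mul_add_sq_le zero_le_one (x - y) (y - z)

lemma ofReal_edge_le (b : X → X → ℝ) (c : X → ℝ) (f : X → ℝ) (x y : X) :
    ENNReal.ofReal (b x y * (f x - f y) ^ 2) ≤ 2 * energy b c f := by
  unfold energy
  rw [mul_add, ← mul_assoc, one_div, ENNReal.mul_inv_cancel (by simp) (by simp), one_mul]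
  exact (ENNReal.le_tsum (f := fun p : X × X =>
    ENNReal.ofReal (b p.1 p.2 * (f p.1 - f p.2) ^ 2)) (x, y)).trans le_self_add

/-- In a connected graph, differences are controlled by the energy. -/
lemma exists_ofReal_sub_sq_le (hconn : Connected b) (c : X → ℝ) (x y : X) :
    ∃ K : ℝ≥0, ∀ f : X → ℝ, ENNReal.ofReal ((f x - f y) ^ 2) ≤ K * energy b c f := by
  induction hconn x y with
  | refl => exact ⟨0, by simp⟩
  | @tail y z _ hyz ih =>
    obtain ⟨K, hK⟩ := ih
    refine ⟨2 * K + 2 * ((b y z)⁻¹.toNNReal * 2), fun f => ?_⟩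
    have hedge : ENNReal.ofReal ((f y - f z) ^ 2) ≤
        ENNReal.ofReal (b y z)⁻¹ * (2 * energy b c f) := by
      refine le_trans (le_of_eq ?_) (mul_le_mul_right (ofReal_edge_le b c f y z) _)
      rw [← ENNReal.ofReal_mul (by positivity), inv_mul_cancel_left₀ hyz.ne']
    calc _ ≤ _ := ofReal_sub_sq_le (f x) (f y) (f z)
      _ ≤ 2 * (K * energy b c f) + 2 * (ENNReal.ofReal (b y z)⁻¹ * (2 * energy b c f)) := by
        gcongr
        exact hK f
      _ = _ := by
        push_cast [ENNReal.ofReal]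
        ring

lemma FinSupp.sub {f g : X → ℝ} (hf : FinSupp f) (hg : FinSupp g) : FinSupp (f - g) :=
  (hf.union hg).subset (Function.support_sub f g)

lemma FinSupp.const_mul {f : X → ℝ} (hf : FinSupp f) (a : ℝ) : FinSupp (fun x => a * f x) :=
  hf.subset fun x hx => by
    simp only [Function.mem_support] at hx ⊢
    exact right_ne_zero_of_mul hx

lemma FinSupp.exists_eq_zero [Infinite X] {f : X → ℝ} (hf : FinSupp f) : ∃ y, f y = 0 := by
  obtain ⟨y, hy⟩ := hf.exists_notMem
  exact ⟨y, by simpa using hy⟩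

lemma bddAbove_gamma (hconn : Connected b) (c : X → ℝ) (x y : X) :
    BddAbove {d : ℝ | ∃ φ : X → ℝ, FinSupp φ ∧ energy b c φ ≤ 1 ∧ d = |φ x - φ y|} := by
  obtain ⟨K, hK⟩ := exists_ofReal_sub_sq_le hconn c x y
  refine ⟨√K, ?_⟩
  rintro _ ⟨φ, -, hφ, rfl⟩
  apply Real.abs_le_sqrt
  have : ENNReal.ofReal ((φ x - φ y) ^ 2) ≤ K := (hK φ).trans (mul_le_of_le_one_right' hφ)
  rwa [← ENNReal.ofReal_coe_nnreal, ENNReal.ofReal_le_ofReal_iff K.coe_nonneg] at this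

lemma gammaO_le_gamma (hconn : Connected b) (c : X → ℝ) (o x y : X) :
    gammaO b c o x y ≤ gamma b c x y := by
  refine csSup_le_csSup (bddAbove_gamma hconn c x y)
    ⟨0, 0, by simp [FinSupp], by simp [energy], by simp⟩ ?_
  rintro d ⟨φ, h1, h2, h3⟩
  exact ⟨φ, h1, le_self_add.trans h2, h3⟩

lemma abs_le_of_gammaO_le [Infinite X] (hconn : Connected b) {o : X} {C : ℝ}
    (hC : ∀ x y, gammaO b c o x y ≤ C) {φ : X → ℝ} (hφ : FinSupp φ) {t : ℝ} (ht : 0 < t)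
    (hle : energy b c φ + ENNReal.ofReal (φ o ^ 2) ≤ ENNReal.ofReal (t ^ 2)) (x : X) :
    |φ x| ≤ C * t := by
  obtain ⟨y, hy⟩ := hφ.exists_eq_zero
  have hmem : |t⁻¹ * φ x - t⁻¹ * φ y| ≤ gammaO b c o x y := by
    refine le_csSup ((bddAbove_gamma hconn c x y).mono ?_) ⟨_, hφ.const_mul t⁻¹, ?_, rfl⟩
    · rintro d ⟨φ, h1, h2, h3⟩
      exact ⟨φ, h1, le_self_add.trans h2, h3⟩
    · rw [energy_const_mul, mul_pow, ENNReal.ofReal_mul (by positivity), ← mul_add]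
      refine (mul_le_mul_right hle _).trans_eq ?_
      rw [← ENNReal.ofReal_mul (by positivity), ← mul_pow, inv_mul_cancel₀ ht.ne']
      simp
  have := hmem.trans (hC x y)
  rw [hy, mul_zero, sub_zero, abs_mul, abs_of_pos (inv_pos.2 ht), inv_mul_le_iff₀ ht] at this
  linarith

lemma uniformlyTransient_of_gammaO_le [Infinite X] (h : IsGraph b c) (hconn : Connected b)
    {o : X} {C : ℝ} (hC0 : 0 ≤ C) (hC : ∀ x y, gammaO b c o x y ≤ C) :
    UniformlyTransient b c := by
  rintro f ⟨φ, hφ, hlim, hQ⟩ ε hε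
  obtain ⟨t, ht, htε⟩ : ∃ t : ℝ, 0 < t ∧ C * t < ε :=
    ⟨ε / (C + 1), by positivity, by rw [mul_div_assoc', div_lt_iff₀ (by positivity)]; nlinarith⟩
  have ho : Tendsto (fun n => ENNReal.ofReal ((φ n o - f o) ^ 2)) atTop (𝓝 0) := by
    simpa using ENNReal.tendsto_ofReal (((hlim o).sub_const (f o)).pow 2)
  have hsum : Tendsto (fun n => 2 * energy b c (φ n - f) +
      2 * ENNReal.ofReal ((φ n o - f o) ^ 2)) atTop (𝓝 0) := by
    simpa using (ENNReal.Tendsto.const_mul hQ (.inr (by simp))).add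
      (ENNReal.Tendsto.const_mul ho (.inr (by simp)))
  have hpos : (0 : ℝ≥0∞) < ENNReal.ofReal (t ^ 2 / 2) := by
    rw [ENNReal.ofReal_pos]
    positivity
  obtain ⟨N, hN⟩ := eventually_atTop.1 (hsum.eventually_lt_const hpos)
  have hclose : ∀ m ≥ N, ∀ x, |φ N x - φ m x| ≤ C * t := by
    intro m hm x
    refine abs_le_of_gammaO_le hconn hC ((hφ N).sub (hφ m)) ht ?_ x
    have h1 : energy b c (φ N - φ m) ≤
        2 * energy b c (φ N - f) + 2 * energy b c (φ m - f) := by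
      simpa using energy_sub_le h (φ N - f) (φ m - f)
    have h2 : ENNReal.ofReal ((φ N o - φ m o) ^ 2) ≤
        2 * ENNReal.ofReal ((φ N o - f o) ^ 2) + 2 * ENNReal.ofReal ((φ m o - f o) ^ 2) := by
      simpa only [sub_sq_comm (f o)] using ofReal_sub_sq_le (φ N o) (f o) (φ m o)
    calc _ ≤ _ := add_le_add h1 h2
      _ = _ := add_add_add_comm _ _ _ _
      _ ≤ _ := add_le_add (hN N le_rfl).le (hN m hm).le
      _ = _ := by
        rw [← ENNReal.ofReal_add (by positivity) (by positivity), add_halves]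
  have hunif (x : X) : |φ N x - f x| ≤ C * t :=
    le_of_tendsto ((hlim x).const_sub (φ N x)).abs
      (eventually_atTop.2 ⟨N, fun m hm => hclose m hm x⟩)
  refine (hφ N).subset fun x hx h0 => ?_
  have hx' := hunif x
  rw [h0, zero_sub, abs_neg] at hx'
  exact absurd (show ε ≤ |f x| from hx) (by linarith)

/-- Under uniform transience, point evaluations on `C_c(X)` are bounded with respect to the
energy. -/
lemma exists_ofReal_sq_le [Infinite X] (h : IsGraph b c) (hconn : Connected b)
    (hut : UniformlyTransient b c) (x : X) :
    ∃ K : ℝ≥0, ∀ φ : X → ℝ, FinSupp φ → ENNReal.ofReal (φ x ^ 2) ≤ K * energy b c φ := by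
  by_contra! hcon
  have hex (n : ℕ) : ∃ φ : X → ℝ, FinSupp φ ∧ φ x = 1 ∧ energy b c φ ≤ ((n : ℝ≥0∞))⁻¹ := by
    obtain ⟨φ, hφ, hlt⟩ := hcon n
    have hx : φ x ≠ 0 := by
      rintro h0
      simp [h0] at hlt
    refine ⟨_, hφ.const_mul (φ x)⁻¹, inv_mul_cancel₀ hx, ?_⟩
    have hpos : 0 < φ x ^ 2 := by positivity
    rw [energy_const_mul, inv_pow, ENNReal.ofReal_inv_of_pos hpos,
      ENNReal.le_inv_iff_mul_le, mul_assoc, mul_comm,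
      ← div_eq_mul_inv]
    refine ENNReal.div_le_of_le_mul ?_
    rw [one_mul, mul_comm]
    exact_mod_cast hlt.le
  choose φ hφ hφx hE using hex
  have hE0 : Tendsto (fun n => energy b c (φ n)) atTop (𝓝 0) :=
    tendsto_of_tendsto_of_tendsto_of_le_of_le tendsto_const_nhds
      ENNReal.tendsto_inv_nat_nhds_zero (fun _ => zero_le) hE
  have hlim (y : X) : Tendsto (fun n => φ n y) atTop (𝓝 ((1 : X → ℝ) y)) := by
    obtain ⟨K, hK⟩ := exists_ofReal_sub_sq_le hconn c y x
    have h0 : Tendsto (fun n => ENNReal.ofReal ((φ n y - φ n x) ^ 2)) atTop (𝓝 0) := by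
      refine tendsto_of_tendsto_of_tendsto_of_le_of_le tendsto_const_nhds ?_
        (fun _ => zero_le) (fun n => hK (φ n))
      simpa using ENNReal.Tendsto.const_mul (a := (K : ℝ≥0∞)) hE0 (.inr (by simp))
    have h1 : Tendsto (fun n => (φ n y - 1) ^ 2) atTop (𝓝 0) := by
      have := (ENNReal.tendsto_toReal ENNReal.zero_ne_top).comp h0
      simpa [Function.comp_def, hφx, ENNReal.toReal_ofReal, sq_nonneg] using this
    have h2 : Tendsto (fun n => |φ n y - 1|) atTop (𝓝 0) := by
      simpa [Real.sqrt_sq_eq_abs] using h1.sqrt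
    rw [tendsto_iff_dist_tendsto_zero]
    simpa [Real.dist_eq] using h2
  have hone : energy b c 1 = 0 := by
    refine le_antisymm (_root_.le_of_forall_pos_le_add fun ε hε => ?_) zero_le
    rw [zero_add]
    exact energy_le_of_tendsto hlim ((hE0.eventually_lt_const hε).mono fun _ => le_of_lt)
  have hmem : MemD0 b c 1 := by
    refine ⟨φ, hφ, hlim, tendsto_of_tendsto_of_tendsto_of_le_of_le tendsto_const_nhds ?_
      (fun _ => zero_le) (fun n => energy_sub_le h (φ n) 1)⟩
    simpa [hone] using ENNReal.Tendsto.const_mul (a := 2) hE0 (.inr (by simp))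
  have hfin := hut 1 hmem 1 one_pos
  refine Set.infinite_univ (hfin.subset fun y _ => ?_)
  change 1 ≤ |(1 : ℝ)|
  simp

lemma energy_sum_range_le (h : IsGraph b c) {ψ : ℕ → X → ℝ}
    (hψ : ∀ n, energy b c (ψ n) ≤ ENNReal.ofReal ((1 / 16) ^ n)) (k N : ℕ) :
    energy b c (∑ i ∈ Finset.range k, ψ (N + i)) ≤ ENNReal.ofReal (4 * (1 / 16) ^ N) := by
  induction k generalizing N with
  | zero => simp [energy]
  | succ k ih =>
    rw [Finset.sum_range_succ']
    refine (energy_add_le h _ _).trans ?_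
    have h1 := ih (N + 1)
    simp only [add_assoc, add_comm 1] at h1
    calc _ ≤ 2 * ENNReal.ofReal (4 * (1 / 16) ^ (N + 1)) + 2 * ENNReal.ofReal ((1 / 16) ^ N) := by
          gcongr
          exact hψ N
      _ = ENNReal.ofReal (2 * (4 * (1 / 16) ^ (N + 1)) + 2 * (1 / 16) ^ N) := by
          rw [ENNReal.ofReal_add (by positivity) (by positivity),
            ENNReal.ofReal_mul zero_le_two, ENNReal.ofReal_mul (p := 2) zero_le_two,
            ENNReal.ofReal_ofNat]
      _ ≤ _ := by
          apply ENNReal.ofReal_le_ofReal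
          have : (0 : ℝ) < (1 / 16) ^ N := by positivity
          rw [pow_succ]
          linarith

lemma exists_abs_le_of_uniformlyTransient [Infinite X] (h : IsGraph b c) (hconn : Connected b)
    (hut : UniformlyTransient b c) :
    ∃ C : ℝ, 0 ≤ C ∧ ∀ φ : X → ℝ, FinSupp φ → energy b c φ ≤ 1 → ∀ x, |φ x| ≤ C := by
  by_contra! hcon
  have hex (n : ℕ) : ∃ ψ : X → ℝ, ∃ x, FinSupp ψ ∧ (∀ y, 0 ≤ ψ y) ∧ ψ x = 1 ∧
      energy b c ψ ≤ ENNReal.ofReal ((1 / 16) ^ n) := by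
    obtain ⟨φ, hφ, hE, x, hx⟩ := hcon (4 ^ n) (by positivity)
    have hpos : 0 < |φ x| := lt_trans (by positivity) hx
    refine ⟨fun y => |φ x|⁻¹ * |φ y|, x, FinSupp.const_mul (hφ.subset ?_) _,
      fun y => by positivity, inv_mul_cancel₀ hpos.ne', ?_⟩
    · intro y hy
      simpa using hy
    · rw [energy_const_mul]
      refine (mul_le_of_le_one_right' ((energy_abs_le h φ).trans hE)).trans ?_
      apply ENNReal.ofReal_le_ofReal
      calc (|φ x|⁻¹) ^ 2 ≤ ((4 ^ n)⁻¹) ^ 2 := by gcongr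
        _ = (1 / 16) ^ n := by
          rw [← inv_pow, ← pow_mul, mul_comm n 2, pow_mul]
          norm_num
  choose ψ x hψ hnn hψx hE using hex
  have hbound (y : X) : ∃ K : ℝ, ∀ n, ψ n y ≤ K * (1 / 4) ^ n := by
    obtain ⟨K, hK⟩ := exists_ofReal_sq_le h hconn hut y
    refine ⟨√K, fun n => ?_⟩
    have h1 := (hK _ (hψ n)).trans (mul_le_mul_right (hE n) _)
    rw [← ENNReal.ofReal_coe_nnreal, ← ENNReal.ofReal_mul K.coe_nonneg,
      ENNReal.ofReal_le_ofReal_iff (mul_nonneg K.coe_nonneg (by positivity))] at h1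
    refine abs_le_of_sq_le_sq' ?_ (by positivity) |>.2
    rw [mul_pow, Real.sq_sqrt K.coe_nonneg, ← pow_mul, mul_comm n 2, pow_mul]
    norm_num at h1 ⊢
    exact h1
  have hgeom : Summable fun n : ℕ => (1 / 4 : ℝ) ^ n :=
    summable_geometric_of_lt_one (by norm_num) (by norm_num)
  have hsum (y : X) : Summable fun n => ψ n y := by
    obtain ⟨K, hK⟩ := hbound y
    exact .of_nonneg_of_le (fun n => hnn n y) hK (hgeom.mul_left K)
  have hmem : MemD0 b c (fun y => ∑' n, ψ n y) := by
    refine ⟨fun N => ∑ i ∈ Finset.range N, ψ i, fun N => ?_, fun y => ?_, ?_⟩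
    · refine ((Finset.range N).finite_toSet.biUnion fun i _ => hψ i).subset fun y hy => ?_
      simp only [Function.mem_support, Finset.sum_apply] at hy
      obtain ⟨i, hi, hne⟩ := Finset.exists_ne_zero_of_sum_ne_zero hy
      exact Set.mem_biUnion hi hne
    · simpa only [Finset.sum_apply] using (hsum y).hasSum.tendsto_sum_nat
    · refine tendsto_of_tendsto_of_tendsto_of_le_of_le tendsto_const_nhds
        (h := fun N : ℕ => ENNReal.ofReal (4 * (1 / 16) ^ N)) ?_ (fun _ => zero_le) fun N => ?_
      · have := (tendsto_pow_atTop_nhds_zero_of_lt_one (r := (1 / 16 : ℝ)) (by norm_num)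
          (by norm_num)).const_mul 4
        simpa using ENNReal.tendsto_ofReal this
      · dsimp only
        rw [energy_sub_comm]
        refine energy_le_of_tendsto (u := fun k => ∑ i ∈ Finset.range k, ψ (N + i)) (fun y => ?_)
          (.of_forall fun k => energy_sum_range_le h hE k N)
        have h1 : ∑' n, ψ n y - ∑ i ∈ Finset.range N, ψ i y = ∑' i, ψ (N + i) y := by
          rw [← (hsum y).sum_add_tsum_nat_add N]
          simp [add_comm]
        simp only [Pi.sub_apply, Finset.sum_apply, h1]
        refine Summable.tendsto_sum_tsum_nat ?_
        simpa only [add_comm N] using (summable_nat_add_iff N).2 (hsum y)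
  have hfin := hut _ hmem 1 one_pos
  have hxmem (n : ℕ) : x n ∈ {y | 1 ≤ |∑' n, ψ n y|} := by
    change 1 ≤ |∑' k, ψ k (x n)|
    refine le_trans ?_ (le_abs_self _)
    rw [← hψx n]
    exact (hsum (x n)).le_tsum n fun i _ => hnn i _
  have hev : ∀ᶠ n in atTop, ∀ y ∈ {y | 1 ≤ |∑' n, ψ n y|}, ψ n y < 1 :=
    (eventually_all_finite hfin).2 fun y _ =>
      (hsum y).tendsto_atTop_zero.eventually_lt_const one_pos
  obtain ⟨n, hn⟩ := hev.exists
  exact (hn _ (hxmem n)).ne (hψx n)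

lemma exists_gamma_le_of_uniformlyTransient [Infinite X] (h : IsGraph b c)
    (hconn : Connected b) (hut : UniformlyTransient b c) :
    ∃ C : ℝ, 0 ≤ C ∧ ∀ x y, gamma b c x y ≤ C := by
  obtain ⟨C, hC0, hC⟩ := exists_abs_le_of_uniformlyTransient h hconn hut
  refine ⟨C + C, by positivity, fun x y => Real.sSup_le ?_ (by positivity)⟩
  rintro _ ⟨φ, hφ, hE, rfl⟩
  exact (abs_sub _ _).trans (add_le_add (hC φ hφ hE x) (hC φ hφ hE y))

end UTGraph

open UTGraph Filter Topology ENNReal in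
/-- uniform transience is equivalent to finiteness of the diameter of
`(X, γ_o)` for one (equivalently all) `o ∈ X`, and to finiteness of the diameter of
`(X, γ)`. -/
theorem stmt12 {X : Type*} [Countable X] [Infinite X]
    (b : X → X → ℝ) (c : X → ℝ) (hgraph : IsGraph b c) (hconn : Connected b) :
    (UniformlyTransient b c ↔
      ∀ o : X, ∃ C : ℝ, 0 ≤ C ∧ ∀ x y : X, gammaO b c o x y ≤ C) ∧
    ((∀ o : X, ∃ C : ℝ, 0 ≤ C ∧ ∀ x y : X, gammaO b c o x y ≤ C) ↔
      (∃ o : X, ∃ C : ℝ, 0 ≤ C ∧ ∀ x y : X, gammaO b c o x y ≤ C)) ∧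
    (UniformlyTransient b c ↔
      ∃ C : ℝ, 0 ≤ C ∧ ∀ x y : X, gamma b c x y ≤ C) := by
  have h21 : (∃ o : X, ∃ C : ℝ, 0 ≤ C ∧ ∀ x y : X, gammaO b c o x y ≤ C) →
      UniformlyTransient b c := fun ⟨_, _, hC0, hC⟩ =>
    uniformlyTransient_of_gammaO_le hgraph hconn hC0 hC
  have h13 := exists_gamma_le_of_uniformlyTransient hgraph hconn
  have h32 : (∃ C : ℝ, 0 ≤ C ∧ ∀ x y : X, gamma b c x y ≤ C) →
      ∀ o : X, ∃ C : ℝ, 0 ≤ C ∧ ∀ x y : X, gammaO b c o x y ≤ C := fun ⟨C, hC0, hC⟩ o =>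
    ⟨C, hC0, fun x y => (gammaO_le_gamma hconn c o x y).trans (hC x y)⟩
  have hall_ex : (∀ o : X, ∃ C : ℝ, 0 ≤ C ∧ ∀ x y : X, gammaO b c o x y ≤ C) →
      ∃ o : X, ∃ C : ℝ, 0 ≤ C ∧ ∀ x y : X, gammaO b c o x y ≤ C := fun h =>
    ⟨Classical.arbitrary X, h _⟩
  exact ⟨⟨fun h => h32 (h13 h), fun h => h21 (hall_ex h)⟩,
    ⟨hall_ex, fun h => h32 (h13 (h21 h))⟩, ⟨h13, fun h => h21 (hall_ex (h32 h))⟩⟩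
end

section
/- Let (b,c) be a connected graph over a countably infinite set X. Then the following are equivalent: (i) (b,c) is transient; (ii) for every o ∈ X the norms ‖·‖_o and Q^{1/2} are equivalent on C_c(X); (ii') the norms ‖·‖_o and Q^{1/2} are equivalent on C_c(X) for one o ∈ X; (iii) for every o ∈ X there exists C_o ≥ 0 with |φ(o)| ≤ C_o · Q(φ)^{1/2} for all φ ∈ C_c(X); (iii') such a C_o exists for one o ∈ X; (iv) cap(o) > 0 for every o ∈ X; (iv') cap(o) > 0 for one o ∈ X. -/
open ENNReal Filter Topology

namespace UTGraph

variable {X : Type*} {b : X → X → ℝ} {c : X → ℝ}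

theorem ofReal_edge_le_two_mul_energy (b : X → X → ℝ) (c f : X → ℝ) (x y : X) :
    ENNReal.ofReal (b x y * (f x - f y) ^ 2) ≤ 2 * energy b c f := by
  have h := ENNReal.le_tsum
    (f := fun p : X × X => ENNReal.ofReal (b p.1 p.2 * (f p.1 - f p.2) ^ 2)) (x, y)
  refine h.trans ?_
  rw [energy, mul_add, ← mul_assoc, one_div,
    ENNReal.mul_inv_cancel two_ne_zero ENNReal.ofNat_ne_top, one_mul]
  exact le_self_add

theorem ofReal_killing_le_energy (b : X → X → ℝ) (c f : X → ℝ) (x : X) :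
    ENNReal.ofReal (c x * f x ^ 2) ≤ energy b c f :=
  (ENNReal.le_tsum (f := fun x => ENNReal.ofReal (c x * f x ^ 2)) x).trans le_add_self

theorem energy_smul (b : X → X → ℝ) (c : X → ℝ) (a : ℝ) (f : X → ℝ) :
    energy b c (a • f) = ENNReal.ofReal (a ^ 2) * energy b c f := by
  have h₁ : ∀ p : X × X, ENNReal.ofReal (b p.1 p.2 * ((a • f) p.1 - (a • f) p.2) ^ 2) =
      ENNReal.ofReal (a ^ 2) * ENNReal.ofReal (b p.1 p.2 * (f p.1 - f p.2) ^ 2) := fun p => by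
    rw [← ENNReal.ofReal_mul (sq_nonneg a)]
    congr 1
    simp only [Pi.smul_apply, smul_eq_mul]
    ring
  have h₂ : ∀ x, ENNReal.ofReal (c x * (a • f) x ^ 2) =
      ENNReal.ofReal (a ^ 2) * ENNReal.ofReal (c x * f x ^ 2) := fun x => by
    rw [← ENNReal.ofReal_mul (sq_nonneg a)]
    congr 1
    simp only [Pi.smul_apply, smul_eq_mul]
    ring
  simp only [energy, h₁, h₂, ENNReal.tsum_mul_left]
  ring

/-- The energy does not see additive constants when the killing term vanishes. -/
theorem energy_sub_one (hc : ∀ x, c x = 0) (f : X → ℝ) :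
    energy b c (f - 1) = energy b c f := by
  simp [energy, hc]

theorem energy_one (hc : ∀ x, c x = 0) : energy b c 1 = 0 := by
  simp [energy, hc]

/-- A constant of vanishing energy forces the killing term to vanish. -/
theorem eq_zero_of_energy_one (hg : IsGraph b c) (h : energy b c 1 = 0) (x : X) : c x = 0 := by
  have hx := ofReal_killing_le_energy b c 1 x
  rw [h, nonpos_iff_eq_zero, ENNReal.ofReal_eq_zero] at hx
  simp only [Pi.one_apply, one_pow, mul_one] at hx
  exact le_antisymm hx (hg.c_nonneg x)

theorem FinSupp.energy_ne_top (hg : IsGraph b c) {f : X → ℝ} (hf : FinSupp f) :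
    energy b c f ≠ ⊤ := by
  have hrow : ∑' p : X × X, ENNReal.ofReal (2 * f p.1 ^ 2 * b p.1 p.2) ≠ ⊤ := by
    rw [ENNReal.tsum_prod', tsum_eq_sum (s := hf.toFinset)]
    · refine ENNReal.sum_ne_top.2 fun x _ => ?_
      exact ((hg.row_summable x).mul_left (2 * f x ^ 2)).tsum_ofReal_ne_top
    · intro x hx
      have : f x = 0 := by simpa [Function.mem_support] using fun h => hx (hf.mem_toFinset.2 h)
      simp [this]
  have hcol : ∑' p : X × X, ENNReal.ofReal (2 * f p.2 ^ 2 * b p.1 p.2) ≠ ⊤ := by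
    rw [← (Equiv.prodComm X X).tsum_eq]
    simpa [hg.symm] using hrow
  have hedge : ∑' p : X × X, ENNReal.ofReal (b p.1 p.2 * (f p.1 - f p.2) ^ 2) ≠ ⊤ := by
    refine ne_top_of_le_ne_top (ENNReal.add_ne_top.2 ⟨hrow, hcol⟩) ?_
    rw [← ENNReal.tsum_add]
    refine ENNReal.tsum_le_tsum fun p => ?_
    have hb := hg.nonneg p.1 p.2
    rw [← ENNReal.ofReal_add (by positivity) (by positivity)]
    refine ENNReal.ofReal_le_ofReal ?_
    nlinarith [mul_nonneg hb (sq_nonneg (f p.1 + f p.2))]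
  have hkill : ∑' x, ENNReal.ofReal (c x * f x ^ 2) ≠ ⊤ := by
    rw [tsum_eq_sum (s := hf.toFinset)]
    · exact ENNReal.sum_ne_top.2 fun x _ => ENNReal.ofReal_ne_top
    · intro x hx
      have : f x = 0 := by simpa [Function.mem_support] using fun h => hx (hf.mem_toFinset.2 h)
      simp [this]
  exact ENNReal.add_ne_top.2 ⟨ENNReal.mul_ne_top (by simp) hedge, hkill⟩

/-- Differences of point evaluations are controlled by the energy. -/
theorem exists_abs_sub_le_sqrt_energy (c : X → ℝ) (hconn : Connected b) (x y : X) :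
    ∃ C : ℝ, 0 ≤ C ∧ ∀ f : X → ℝ, energy b c f ≠ ⊤ →
      |f x - f y| ≤ C * √(energy b c f).toReal := by
  induction hconn x y with
  | refl => exact ⟨0, le_rfl, by simp⟩
  | @tail u v _ huv ih =>
    obtain ⟨C, hC, h⟩ := ih
    refine ⟨C + √(2 / b u v), by positivity, fun f hf => ?_⟩
    have hedge : |f u - f v| ≤ √(2 / b u v) * √(energy b c f).toReal := by
      rw [← Real.sqrt_mul (by positivity)]
      refine Real.abs_le_sqrt ?_
      have := ENNReal.toReal_mono (ENNReal.mul_ne_top ENNReal.ofNat_ne_top hf)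
        (ofReal_edge_le_two_mul_energy b c f u v)
      rw [ENNReal.toReal_ofReal (by positivity), ENNReal.toReal_mul, ENNReal.toReal_ofNat] at this
      rw [div_mul_eq_mul_div, le_div_iff₀ huv]
      linarith
    calc |f x - f v| ≤ |f x - f u| + |f u - f v| := abs_sub_le _ _ _
      _ ≤ C * √(energy b c f).toReal + √(2 / b u v) * √(energy b c f).toReal :=
        add_le_add (h f hf) hedge
      _ = _ := by ring

/-- Evaluation at `o` is bounded on `C_c(X)` with respect to `Q^{1/2}`. -/
def EvalBounded (b : X → X → ℝ) (c : X → ℝ) (o : X) : Prop :=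
  ∃ Co : ℝ, 0 ≤ Co ∧ ∀ φ : X → ℝ, FinSupp φ → |φ o| ≤ Co * √(energy b c φ).toReal

/-- The norms `‖·‖_o` and `Q^{1/2}` are equivalent on `C_c(X)`. -/
def NormsEquivalent (b : X → X → ℝ) (c : X → ℝ) (o : X) : Prop :=
  ∃ c₁ c₂ : ℝ, 0 < c₁ ∧ 0 < c₂ ∧ ∀ φ : X → ℝ, FinSupp φ →
    c₁ * normO b c o φ ≤ √(energy b c φ).toReal ∧ √(energy b c φ).toReal ≤ c₂ * normO b c o φ

theorem EvalBounded.of_connected (hg : IsGraph b c) (hconn : Connected b) {o : X}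
    (h : EvalBounded b c o) (x : X) : EvalBounded b c x := by
  obtain ⟨C, hC, h⟩ := h
  obtain ⟨C', hC', h'⟩ := exists_abs_sub_le_sqrt_energy c hconn x o
  refine ⟨C' + C, by positivity, fun φ hφ => ?_⟩
  calc |φ x| = |(φ x - φ o) + φ o| := by rw [sub_add_cancel]
    _ ≤ |φ x - φ o| + |φ o| := abs_add_le _ _
    _ ≤ C' * √(energy b c φ).toReal + C * √(energy b c φ).toReal :=
      add_le_add (h' φ (hφ.energy_ne_top hg)) (h φ hφ)
    _ = _ := by ring

theorem normsEquivalent_iff_evalBounded (o : X) :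
    NormsEquivalent b c o ↔ EvalBounded b c o := by
  constructor
  · rintro ⟨c₁, _, hc₁, _, h⟩
    refine ⟨c₁⁻¹, by positivity, fun φ hφ => ?_⟩
    rw [inv_mul_eq_div, le_div_iff₀' hc₁]
    refine le_trans ?_ (h φ hφ).1
    gcongr
    exact Real.abs_le_sqrt (le_add_of_nonneg_left ENNReal.toReal_nonneg)
  · rintro ⟨C, hC, h⟩
    refine ⟨(1 + C)⁻¹, 1, by positivity, one_pos, fun φ hφ => ⟨?_, ?_⟩⟩
    · rw [inv_mul_eq_div, div_le_iff₀' (by positivity), normO]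
      calc √((energy b c φ).toReal + φ o ^ 2)
          ≤ √(energy b c φ).toReal + |φ o| := by
            rw [Real.sqrt_le_iff, add_sq, Real.sq_sqrt ENNReal.toReal_nonneg, sq_abs]
            have : 0 ≤ 2 * √(energy b c φ).toReal * |φ o| := by positivity
            exact ⟨by positivity, by linarith⟩
        _ ≤ √(energy b c φ).toReal + C * √(energy b c φ).toReal := by
          gcongr
          exact h φ hφ
        _ = _ := by ring
    · rw [one_mul]
      exact Real.sqrt_le_sqrt (le_add_of_nonneg_right (sq_nonneg _))

theorem EvalBounded.cap_pos (hg : IsGraph b c) {o : X} (h : EvalBounded b c o) :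
    0 < cap b c o := by
  obtain ⟨C, hC, h⟩ := h
  have hpos : (0 : ℝ≥0∞) < ENNReal.ofReal (((1 + C) ^ 2)⁻¹) :=
    ENNReal.ofReal_pos.2 (by positivity)
  refine hpos.trans_le ?_
  refine le_iInf fun φ => le_iInf fun hφ => le_iInf fun hφo => ?_
  rw [ENNReal.ofReal_le_iff_le_toReal (hφ.energy_ne_top hg),
    inv_le_iff_one_le_mul₀' (by positivity)]
  have h1 := h φ hφ
  rw [hφo, abs_one] at h1
  rw [← Real.sq_sqrt (ENNReal.toReal_nonneg (a := energy b c φ)), ← mul_pow]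
  exact one_le_pow₀ (h1.trans (by gcongr; linarith))

theorem evalBounded_of_cap_pos (hg : IsGraph b c) {o : X} (h : 0 < cap b c o) :
    EvalBounded b c o := by
  obtain ⟨r, hr, hrcap⟩ := ENNReal.lt_iff_exists_nnreal_btwn.1 h
  have hr0 : (0 : ℝ) < r := by exact_mod_cast hr
  refine ⟨√((r : ℝ)⁻¹), Real.sqrt_nonneg _, fun φ hφ => ?_⟩
  rw [← Real.sqrt_mul (by positivity)]
  refine Real.abs_le_sqrt ?_
  rcases eq_or_ne (φ o) 0 with h0 | h0
  · rw [h0, zero_pow two_ne_zero]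
    positivity
  have hψ : FinSupp ((φ o)⁻¹ • φ) := hφ.subset (Function.support_const_smul_subset _ _)
  have hle : cap b c o ≤ energy b c ((φ o)⁻¹ • φ) :=
    iInf_le_of_le _ (iInf_le_of_le hψ (iInf_le_of_le (by simp [h0]) le_rfl))
  have hlt := ENNReal.toReal_mono (hψ.energy_ne_top hg) (hrcap.le.trans hle)
  rw [energy_smul, ENNReal.toReal_mul, ENNReal.toReal_ofReal (sq_nonneg _),
    ENNReal.coe_toReal, inv_pow, inv_mul_eq_div, le_div_iff₀ (by positivity)] at hlt
  rwa [inv_mul_eq_div, le_div_iff₀' hr0]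

theorem Recurrent.not_evalBounded (hg : IsGraph b c) (h : Recurrent b c) (o : X) :
    ¬ EvalBounded b c o := by
  rintro ⟨C, -, hC⟩
  obtain ⟨⟨φ, hφ, hlim, hE⟩, h1⟩ := h
  simp only [energy_sub_one (eq_zero_of_energy_one hg h1)] at hE
  have hE' : Tendsto (fun n => C * √(energy b c (φ n)).toReal) atTop (𝓝 0) := by
    have := (Real.continuous_sqrt.tendsto _).comp
      ((ENNReal.tendsto_toReal ENNReal.zero_ne_top).comp hE)
    simpa using this.const_mul C
  have := le_of_tendsto_of_tendsto' (hlim o).abs hE' fun n => hC (φ n) (hφ n)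
  norm_num at this

theorem recurrent_of_cap_eq_zero (hg : IsGraph b c) (hconn : Connected b) {o : X}
    (h : cap b c o = 0) : Recurrent b c := by
  have hex : ∀ n : ℕ, ∃ φ : X → ℝ, FinSupp φ ∧ φ o = 1 ∧
      energy b c φ < ((n : ℝ≥0∞) + 1)⁻¹ := fun n => by
    have hlt : cap b c o < ((n : ℝ≥0∞) + 1)⁻¹ := by
      rw [h, ENNReal.inv_pos]
      exact ENNReal.add_ne_top.2 ⟨ENNReal.natCast_ne_top n, ENNReal.one_ne_top⟩
    simp only [cap, iInf_lt_iff] at hlt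
    obtain ⟨φ, h₁, h₂, h₃⟩ := hlt
    exact ⟨φ, h₁, h₂, h₃⟩
  choose φ hφ hφo hφE using hex
  have hE : Tendsto (fun n => energy b c (φ n)) atTop (𝓝 0) := by
    have hinv : Tendsto (fun n : ℕ => ((n : ℝ≥0∞) + 1)⁻¹) atTop (𝓝 0) := by
      have := ENNReal.tendsto_inv_nat_nhds_zero.comp (tendsto_add_atTop_nat 1)
      simpa [Function.comp_def] using this
    exact tendsto_of_tendsto_of_tendsto_of_le_of_le tendsto_const_nhds hinv
      (fun n => zero_le) (fun n => (hφE n).le)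
  have hreal : Tendsto (fun n => (energy b c (φ n)).toReal) atTop (𝓝 0) := by
    simpa [Function.comp_def] using (ENNReal.tendsto_toReal ENNReal.zero_ne_top).comp hE
  have hlim : ∀ x, Tendsto (fun n => φ n x) atTop (𝓝 1) := fun x => by
    obtain ⟨C, -, hC⟩ := exists_abs_sub_le_sqrt_energy c hconn x o
    rw [tendsto_iff_norm_sub_tendsto_zero]
    refine squeeze_zero (fun n => norm_nonneg _) (fun n => ?_)
      (g := fun n => C * √(energy b c (φ n)).toReal) ?_
    · have := hC (φ n) ((hφ n).energy_ne_top hg)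
      rwa [hφo] at this
    · simpa using (((Real.continuous_sqrt.tendsto _).comp hreal).const_mul C)
  have hc : ∀ x, c x = 0 := fun x => by
    refine le_antisymm ?_ (hg.c_nonneg x)
    have hkill : Tendsto (fun n => c x * φ n x ^ 2) atTop (𝓝 (c x)) := by
      simpa using ((hlim x).pow 2).const_mul (c x)
    refine le_of_tendsto_of_tendsto' hkill hreal fun n => ?_
    rw [← ENNReal.ofReal_le_iff_le_toReal ((hφ n).energy_ne_top hg)]
    exact ofReal_killing_le_energy b c (φ n) x
  refine ⟨⟨φ, hφ, hlim, ?_⟩, energy_one hc⟩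
  simpa only [energy_sub_one hc] using hE

theorem cap_pos_iff_evalBounded (hg : IsGraph b c) (o : X) :
    0 < cap b c o ↔ EvalBounded b c o :=
  ⟨evalBounded_of_cap_pos hg, EvalBounded.cap_pos hg⟩

theorem transient_iff_evalBounded (hg : IsGraph b c) (hconn : Connected b) (o : X) :
    Transient b c ↔ EvalBounded b c o := by
  refine ⟨fun h => ?_, fun h hrec => hrec.not_evalBounded hg o h⟩
  rw [← cap_pos_iff_evalBounded hg, pos_iff_ne_zero]
  exact fun h0 => h (recurrent_of_cap_eq_zero hg hconn h0)

end UTGraph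

open UTGraph Filter Topology ENNReal in
/-- characterization of transience: transience is equivalent to the
equivalence of the norms `‖·‖_o` and `Q^{1/2}` on `C_c(X)` for all (equivalently,
one) `o`, to the point evaluation bound `|φ(o)| ≤ C_o Q(φ)^{1/2}` for all
(equivalently, one) `o`, and to the positivity of the capacity of all
(equivalently, one) point. -/
theorem stmt18 {X : Type*} [Countable X] [Infinite X]
    (b : X → X → ℝ) (c : X → ℝ) (hgraph : IsGraph b c) (hconn : Connected b) :
    (Transient b c ↔
      ∀ o : X, ∃ c₁ c₂ : ℝ, 0 < c₁ ∧ 0 < c₂ ∧ ∀ φ : X → ℝ, FinSupp φ →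
        c₁ * normO b c o φ ≤ Real.sqrt (energy b c φ).toReal ∧
        Real.sqrt (energy b c φ).toReal ≤ c₂ * normO b c o φ) ∧
    ((∀ o : X, ∃ c₁ c₂ : ℝ, 0 < c₁ ∧ 0 < c₂ ∧ ∀ φ : X → ℝ, FinSupp φ →
        c₁ * normO b c o φ ≤ Real.sqrt (energy b c φ).toReal ∧
        Real.sqrt (energy b c φ).toReal ≤ c₂ * normO b c o φ) ↔
      (∃ o : X, ∃ c₁ c₂ : ℝ, 0 < c₁ ∧ 0 < c₂ ∧ ∀ φ : X → ℝ, FinSupp φ →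
        c₁ * normO b c o φ ≤ Real.sqrt (energy b c φ).toReal ∧
        Real.sqrt (energy b c φ).toReal ≤ c₂ * normO b c o φ)) ∧
    (Transient b c ↔
      ∀ o : X, ∃ Co : ℝ, 0 ≤ Co ∧ ∀ φ : X → ℝ, FinSupp φ →
        |φ o| ≤ Co * Real.sqrt (energy b c φ).toReal) ∧
    ((∀ o : X, ∃ Co : ℝ, 0 ≤ Co ∧ ∀ φ : X → ℝ, FinSupp φ →
        |φ o| ≤ Co * Real.sqrt (energy b c φ).toReal) ↔
      (∃ o : X, ∃ Co : ℝ, 0 ≤ Co ∧ ∀ φ : X → ℝ, FinSupp φ →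
        |φ o| ≤ Co * Real.sqrt (energy b c φ).toReal)) ∧
    (Transient b c ↔ ∀ o : X, 0 < cap b c o) ∧
    ((∀ o : X, 0 < cap b c o) ↔ (∃ o : X, 0 < cap b c o)) := by
  have hall : (∀ o, EvalBounded b c o) ↔ ∃ o, EvalBounded b c o :=
    ⟨fun h => ⟨Classical.arbitrary X, h _⟩, fun ⟨_, h⟩ => h.of_connected hgraph hconn⟩
  have htrans : Transient b c ↔ ∀ o, EvalBounded b c o := by
    rw [hall, transient_iff_evalBounded hgraph hconn (Classical.arbitrary X)]
    exact ⟨fun h => ⟨_, h⟩, fun ⟨_, h⟩ => h.of_connected hgraph hconn _⟩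
  change (_ ↔ ∀ o, NormsEquivalent b c o) ∧
    ((∀ o, NormsEquivalent b c o) ↔ ∃ o, NormsEquivalent b c o) ∧
    (_ ↔ ∀ o, EvalBounded b c o) ∧ ((∀ o, EvalBounded b c o) ↔ ∃ o, EvalBounded b c o) ∧ _
  simp only [normsEquivalent_iff_evalBounded, cap_pos_iff_evalBounded hgraph]
  exact ⟨htrans, hall, htrans, hall, htrans, hall⟩
end
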